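/- Let (A, A′, A″) be a triple of toric arrangements on Tⁿ with distinguished hyperplane H₀ ∈ A, where A′ = A \ {H₀} and A″ is the restriction of A to H₀; assume |A| ≥ n + 1, that A, A′ and A″ are spanning and in general position, and that every flat of these arrangements is simply connected. Then for every 0 ≤ k ≤ n, f_k(A) = f_k(A′) + f_k(A″) + f_{k−1}(A″), with the conventions f_{−1}(A″) = 0 and f_n(A″) = 0. -/

import Mathlib

open Set

/-- The `n`-torus `ℝⁿ/ℤⁿ`, modelled as a product of circles `ℝ/ℤ`. -/
abbrev Torus (n : ℕ) := Fin n → AddCircle (1 : ℝ)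

/-- The group homomorphism `Tⁿ → ℝ/ℤ` induced by `x ↦ a₁x₁ + ⋯ + aₙxₙ`. -/
noncomputable def theta {n : ℕ} (a : Fin n → ℤ) (x : Torus n) : AddCircle (1 : ℝ) :=
  ∑ i, a i • x i

/-- The affine toric hyperplane with normal vector `a` and intercept `c`. -/
def Hyp {n : ℕ} (a : Fin n → ℤ) (c : AddCircle (1 : ℝ)) : Set (Torus n) :=
  {x | theta a x = c}

/-- The set of connected components of a subset `A` of a topological space. -/
def comps {X : Type*} [TopologicalSpace X] (A : Set X) : Set (Set X) :=
  {C | ∃ x ∈ A, C = connectedComponentIn A x}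

/-- The set `Σ_k` of `k`-flats of an arrangement of hypersurfaces `K i` inside an
ambient space `W` of dimension `d`: `Σ_0` is the set of connected components of the
union over `d`-element index sets `S` of `⋂_{i ∈ S} K i`; for `0 < k < d`, `Σ_k` is the
union over `(d-k)`-element index sets `S` of the sets of connected components of
`⋂_{i ∈ S} K i` minus all lower-dimensional flats; and `Σ_d` is the set of connected
components of the complement `W \ ⋃ᵢ K i`. -/
noncomputable def SigIn {X : Type*} [TopologicalSpace X] {ι : Type*} [Fintype ι]
    (W : Set X) (d : ℕ) (K : ι → Set X) : ℕ → Set (Set X) := fun k =>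
  Nat.strongRecOn k (fun k ih =>
    if k = 0 then comps (⋃ S ∈ {S : Finset ι | S.card = d}, ⋂ i ∈ S, K i)
    else if k = d then comps (W \ ⋃ i, K i)
    else ⋃ S ∈ {S : Finset ι | S.card = d - k},
      comps ((⋂ i ∈ S, K i) \ ⋃ j : Fin k, ⋃ σ ∈ ih j j.isLt, σ))

/-- An arrangement (given by normal vectors `a`) is spanning if some `n` of the normal
vectors are linearly independent over `ℚ`. -/
def Spanning {ι : Type*} [Fintype ι] {n : ℕ} (a : ι → Fin n → ℤ) : Prop :=
  ∃ s : Finset ι, s.card = n ∧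
    LinearIndependent ℚ (fun i : s => fun j => (a i.1 j : ℚ))

/-- An arrangement is in general position if for every subset `S` of hyperplanes with
nonempty intersection, the corresponding normal vectors are linearly independent over `ℚ`. -/
def GenPos {ι : Type*} [Fintype ι] {n : ℕ} (a : ι → Fin n → ℤ)
    (b : ι → AddCircle (1 : ℝ)) : Prop :=
  ∀ S : Finset ι, (⋂ i ∈ S, Hyp (a i) (b i)).Nonempty →
    LinearIndependent ℚ (fun i : S => fun j => (a i.1 j : ℚ))


/-- A torus of dimension one is not simply connected. -/
theorem not_simplyConnectedSpace_torus_one : ¬ SimplyConnectedSpace (Torus 1) := by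
  intro h
  have cov : IsCoveringMap ((↑) : ℝ → AddCircle (1 : ℝ)) := AddCircle.isCoveringMap_coe 1
  have h1 : ((1 : ℝ) : AddCircle (1 : ℝ)) = 0 := AddCircle.coe_period 1
  let γ : Path (0 : Torus 1) 0 :=
    { toFun := fun t _ => ((t : ℝ) : AddCircle (1 : ℝ))
      continuous_toFun := continuous_pi fun _ =>
        (AddCircle.continuous_mk' 1).comp continuous_subtype_val
      source' := by funext i; simp
      target' := by funext i; simp [h1] }
  have hγ := SimplyConnectedSpace.paths_homotopic γ (Path.refl 0)
  have hmap := hγ.map (⟨fun x => x 0, continuous_apply 0⟩ : C(Torus 1, AddCircle (1 : ℝ)))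
  obtain ⟨F⟩ := hmap
  have h0 := cov.liftPath_apply_one_eq_of_homotopicRel (e := 0) ⟨F⟩ (by simp) (by simp)
  have e1 : (⟨fun t : unitInterval => (t : ℝ), continuous_subtype_val⟩ : C(unitInterval, ℝ)) =
      _ := (cov.eq_liftPath_iff' (γ := (γ.map (continuous_apply 0)).toContinuousMap) (e := 0)
        (by simp)).mpr ⟨rfl, rfl⟩
  have e2 : (ContinuousMap.const unitInterval (0 : ℝ)) =
      _ := (cov.eq_liftPath_iff' (γ := ((Path.refl (0 : Torus 1)).map
        (continuous_apply 0)).toContinuousMap) (e := 0)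
        (by simp)).mpr ⟨by funext t; simp, rfl⟩
  have h2 := (congrArg (fun f : C(unitInterval, ℝ) => f 1) e1).trans
    (h0.trans (congrArg (fun f : C(unitInterval, ℝ) => f 1) e2).symm)
  simp at h2

open scoped Classical in
/-- The index set of the members of the family `K` containing the point `x`. -/
noncomputable def incid {X ι : Type*} [Fintype ι] (K : ι → Set X) (x : X) : Finset ι :=
  Finset.univ.filter fun i => x ∈ K i

theorem mem_incid {X ι : Type*} [Fintype ι] {K : ι → Set X} {x : X} {i : ι} :
    i ∈ incid K x ↔ x ∈ K i := by
  simp [incid]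

/-- The components of the strata of `W` on which exactly `r` members of `K` meet. -/
def strataComps {X : Type*} [TopologicalSpace X] {ι : Type*} [Fintype ι]
    (W : Set X) (K : ι → Set X) (r : ℕ) : Set (Set X) :=
  {C | ∃ x ∈ W, (incid K x).card = r ∧
    C = connectedComponentIn {y ∈ W | incid K y = incid K x} x}

theorem SigIn_eq {X : Type*} [TopologicalSpace X] {ι : Type*} [Fintype ι]
    (W : Set X) (d : ℕ) (K : ι → Set X) (k : ℕ) :
    SigIn W d K k =
      if k = 0 then comps (⋃ S ∈ {S : Finset ι | S.card = d}, ⋂ i ∈ S, K i)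
      else if k = d then comps (W \ ⋃ i, K i)
      else ⋃ S ∈ {S : Finset ι | S.card = d - k},
        comps ((⋂ i ∈ S, K i) \ ⋃ j : Fin k, ⋃ σ ∈ SigIn W d K j, σ) := by
  rw [SigIn, Nat.strongRecOn_eq]
  rfl

theorem sUnion_strataComps {X : Type*} [TopologicalSpace X] {ι : Type*} [Fintype ι]
    (W : Set X) (K : ι → Set X) (r : ℕ) :
    ⋃ σ ∈ strataComps W K r, σ = {x ∈ W | (incid K x).card = r} := by
  ext x
  simp only [mem_iUnion, exists_prop, mem_ofPred_eq]
  constructor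
  · rintro ⟨_, ⟨y, hy, hr, rfl⟩, hx⟩
    have := connectedComponentIn_subset _ _ hx
    exact ⟨this.1, this.2 ▸ hr⟩
  · rintro ⟨hx, hr⟩
    exact ⟨_, ⟨x, hx, hr, rfl⟩, mem_connectedComponentIn ⟨hx, rfl⟩⟩

/-- Since at most `d` of the closed sets `K i` meet, the locus where `d` of them meet is the
disjoint union of closed pieces, so that components may be taken piecewise. -/
theorem connectedComponentIn_card_eq {X : Type*} [TopologicalSpace X] {ι : Type*} [Fintype ι]
    (K : ι → Set X) (hcl : ∀ i, IsClosed (K i)) {d : ℕ} (hcard : ∀ x, (incid K x).card ≤ d)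
    {x : X} (hx : (incid K x).card = d) :
    connectedComponentIn {y | (incid K y).card = d} x =
      connectedComponentIn {y | incid K y = incid K x} x := by
  have hpiece : ∀ S : Finset ι, S.card = d → {y | incid K y = S} = ⋂ i ∈ S, K i := by
    intro S hS
    ext y
    simp only [mem_ofPred_eq, mem_iInter, ← mem_incid (K := K)]
    refine ⟨fun h i hi => h ▸ hi, fun h => ?_⟩
    exact (Finset.eq_of_subset_of_card_le h (hS ▸ hcard y)).symm
  have hclosed : ∀ S : Finset ι, S.card = d → IsClosed {y | incid K y = S} := by
    intro S hS
    rw [hpiece S hS]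
    exact isClosed_biInter fun i _ => hcl i
  apply Subset.antisymm
  · refine isPreconnected_connectedComponentIn.subset_connectedComponentIn
      (mem_connectedComponentIn hx) ?_
    have hpc : IsPreconnected (connectedComponentIn {y | (incid K y).card = d} x) :=
      isPreconnected_connectedComponentIn
    have hsub := connectedComponentIn_subset {y | (incid K y).card = d} x
    have hv : IsClosed (⋃ S ∈ {S : Finset ι | S.card = d ∧ S ≠ incid K x},
        {y | incid K y = S}) :=
      (Set.toFinite _).isClosed_biUnion fun S hS => hclosed S hS.1
    have hcover : connectedComponentIn {y | (incid K y).card = d} x ⊆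
        {y | incid K y = incid K x} ∪ ⋃ S ∈ {S : Finset ι | S.card = d ∧ S ≠ incid K x},
          {y | incid K y = S} := by
      intro y hy
      by_cases h : incid K y = incid K x
      · exact Or.inl h
      · exact Or.inr (mem_biUnion (x := incid K y) ⟨hsub hy, h⟩ rfl)
    rcases isPreconnected_iff_subset_of_disjoint_closed.1 hpc _ _ (hclosed _ hx) hv hcover
      (by
        rw [eq_empty_iff_forall_notMem]
        rintro y ⟨-, hy, hy'⟩
        simp only [mem_ofPred_eq, mem_iUnion, exists_prop] at hy hy'
        obtain ⟨S, ⟨-, hS⟩, rfl⟩ := hy'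
        exact hS hy) with h | h
    · exact h
    · have := h (mem_connectedComponentIn hx)
      simp at this
  · exact connectedComponentIn_mono _ fun y hy => by
      rw [mem_ofPred_eq] at hy ⊢; rw [hy, hx]

/-- When at most `d` of the hypersurfaces meet, the `k`-flats are the components of the strata
where exactly `d - k` of them meet. -/
theorem SigIn_eq_strataComps {X : Type*} [TopologicalSpace X] {ι : Type*} [Fintype ι]
    {W : Set X} {d : ℕ} {K : ι → Set X} (hd : 0 < d) (hW : ∀ i, K i ⊆ W)
    (hcl : ∀ i, IsClosed (K i)) (hcard : ∀ x, (incid K x).card ≤ d) :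
    ∀ {k : ℕ}, k ≤ d → SigIn W d K k = strataComps W K (d - k) := by
  intro k
  have hWne : ∀ {y : X}, 0 < (incid K y).card → y ∈ W := by
    intro y hy
    obtain ⟨i, hi⟩ := Finset.card_pos.1 hy
    exact hW i (mem_incid.1 hi)
  induction k using Nat.strong_induction_on with
  | _ k ih =>
  intro hk
  rw [SigIn_eq]
  split_ifs with h0 hkd
  · subst h0
    have hset : (⋃ S ∈ {S : Finset ι | S.card = d}, ⋂ i ∈ S, K i) =
        {y | (incid K y).card = d} := by
      ext y
      simp only [mem_ofPred_eq, mem_iUnion, mem_iInter, exists_prop, ← mem_incid (K := K)]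
      constructor
      · rintro ⟨S, hS, h⟩
        exact le_antisymm (hcard y) (hS ▸ Finset.card_le_card h)
      · exact fun h => ⟨_, h, fun i hi => hi⟩
    rw [hset]
    have hWx : ∀ {x : X}, (incid K x).card = d →
        {y ∈ W | incid K y = incid K x} = {y | incid K y = incid K x} := by
      intro x hx
      ext y
      simp only [mem_ofPred_eq, and_iff_right_iff_imp]
      intro hy
      exact hWne (by rw [hy, hx]; exact hd)
    ext C
    simp only [comps, strataComps, mem_ofPred_eq, Nat.sub_zero]
    constructor
    · rintro ⟨x, hx, rfl⟩
      refine ⟨x, hWne (by omega), hx, ?_⟩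
      rw [hWx hx, connectedComponentIn_card_eq K hcl hcard hx]
    · rintro ⟨x, -, hx, rfl⟩
      refine ⟨x, hx, ?_⟩
      rw [hWx hx, connectedComponentIn_card_eq K hcl hcard hx]
  · subst hkd
    have hset : ∀ {x : X}, (incid K x).card = 0 →
        {y ∈ W | incid K y = incid K x} = W \ ⋃ i, K i := by
      intro x hx
      ext y
      rw [Finset.card_eq_zero.1 hx]
      simp [Finset.eq_empty_iff_forall_notMem, mem_incid]
    ext C
    simp only [comps, strataComps, mem_ofPred_eq, Nat.sub_self]
    constructor
    · rintro ⟨x, hx, rfl⟩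
      have h0 : (incid K x).card = 0 := by
        rw [Finset.card_eq_zero, Finset.eq_empty_iff_forall_notMem]
        intro i hi
        exact hx.2 (mem_iUnion.2 ⟨i, mem_incid.1 hi⟩)
      exact ⟨x, hx.1, h0, by rw [hset h0]⟩
    · rintro ⟨x, hx, h0, rfl⟩
      have : x ∈ {y ∈ W | incid K y = incid K x} := ⟨hx, rfl⟩
      rw [hset h0] at this
      exact ⟨x, this, by rw [hset h0]⟩
  · have hlow : (⋃ j : Fin k, ⋃ σ ∈ SigIn W d K j, σ) =
        {x | d - k < (incid K x).card} := by
      ext x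
      have : ∀ j : Fin k, ⋃ σ ∈ SigIn W d K j, σ = {x ∈ W | (incid K x).card = d - j} := by
        intro j
        rw [ih j j.isLt (by omega), sUnion_strataComps]
      simp only [this, mem_iUnion, mem_ofPred_eq]
      constructor
      · rintro ⟨j, -, hj⟩
        have := j.isLt
        omega
      · intro h
        have := hcard x
        exact ⟨⟨d - (incid K x).card, by omega⟩, hWne (by omega), by simp only; omega⟩
    have hset : ∀ {S : Finset ι}, S.card = d - k →
        (⋂ i ∈ S, K i) \ {x | d - k < (incid K x).card} = {y ∈ W | incid K y = S} := by
      intro S hS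
      ext y
      simp only [mem_sdiff, mem_ofPred_eq, mem_iInter, ← mem_incid (K := K), not_lt]
      constructor
      · rintro ⟨h1, h2⟩
        have h3 := Finset.eq_of_subset_of_card_le h1 (by omega)
        exact ⟨hWne (by rw [← h3]; omega), h3.symm⟩
      · rintro ⟨-, rfl⟩
        exact ⟨fun i hi => hi, hS.le⟩
    rw [hlow]
    ext C
    simp only [comps, strataComps, mem_ofPred_eq, mem_iUnion, exists_prop]
    constructor
    · rintro ⟨S, hS, x, hx, rfl⟩
      rw [hset hS] at hx ⊢
      obtain ⟨hxW, rfl⟩ := hx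
      exact ⟨x, hxW, hS, rfl⟩
    · rintro ⟨x, hxW, hr, rfl⟩
      exact ⟨_, hr, x, by rw [hset hr]; exact ⟨hxW, rfl⟩, by rw [hset hr]⟩

/-- The integer `⌊u⌋ + ⌈u⌉`, which is `2 * j` when `u = j` and `2 * j + 1` when
`j < u < j + 1`. -/
noncomputable def floorCeil (u : ℝ) : ℤ := ⌊u⌋ + ⌈u⌉

theorem floorCeil_mono : Monotone floorCeil := fun _ _ h =>
  add_le_add (Int.floor_mono h) (Int.ceil_mono h)

theorem floorCeil_intCast (j : ℤ) : floorCeil j = 2 * j := by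
  simp [floorCeil]; ring

theorem floorCeil_of_mem_Ioo {u : ℝ} {j : ℤ} (h1 : (j : ℝ) < u) (h2 : u < j + 1) :
    floorCeil u = 2 * j + 1 := by
  have hf : ⌊u⌋ = j := Int.floor_eq_iff.2 ⟨h1.le, h2⟩
  have hc : ⌈u⌉ = j + 1 := Int.ceil_eq_iff.2 ⟨by push_cast; linarith, by push_cast; linarith⟩
  rw [floorCeil, hf, hc]; ring

theorem floorCeil_cases (u : ℝ) :
    (∃ j : ℤ, u = j ∧ floorCeil u = 2 * j) ∨
      ∃ j : ℤ, (j : ℝ) < u ∧ u < j + 1 ∧ floorCeil u = 2 * j + 1 := by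
  rcases (Int.floor_le u).eq_or_lt with h | h
  · exact Or.inl ⟨⌊u⌋, h.symm, by conv_lhs => rw [← h, floorCeil_intCast]⟩
  · exact Or.inr ⟨⌊u⌋, h, Int.lt_floor_add_one u,
      floorCeil_of_mem_Ioo h (Int.lt_floor_add_one u)⟩

theorem even_floorCeil {u : ℝ} : Even (floorCeil u) ↔ ∃ j : ℤ, u = j := by
  constructor
  · intro h
    rcases floorCeil_cases u with ⟨j, hj, -⟩ | ⟨j, -, -, hj⟩
    · exact ⟨j, hj⟩
    · rw [hj] at h; exact absurd h (by simp)
  · rintro ⟨j, rfl⟩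
    simp [floorCeil_intCast]

theorem floorCeil_add_intCast (u : ℝ) (j : ℤ) : floorCeil (u + j) = floorCeil u + 2 * j := by
  simp [floorCeil]; ring

theorem floorCeil_half (z : ℤ) : floorCeil ((z : ℝ) / 2) = z := by
  rcases Int.even_or_odd' z with ⟨j, rfl | rfl⟩
  · have : (((2 * j : ℤ) : ℝ)) / 2 = (j : ℝ) := by push_cast; ring
    rw [this, floorCeil_intCast]
  · apply floorCeil_of_mem_Ioo <;> push_cast <;> linarith

theorem mem_Ioo_floorCeil (u : ℝ) :
    u ∈ Ioo (((floorCeil u : ℝ) - 1) / 2) (((floorCeil u : ℝ) + 1) / 2) := by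
  rcases floorCeil_cases u with ⟨j, hj, h⟩ | ⟨j, h1, h2, h⟩ <;> rw [h] <;> push_cast <;>
    constructor <;> linarith

theorem floorCeil_eq_of_mem_Ioo {u : ℝ} {c : ℤ}
    (hu : u ∈ Ioo (((c : ℝ) - 1) / 2) (((c : ℝ) + 1) / 2))
    (hpar : Even (floorCeil u) ↔ Even c) : floorCeil u = c := by
  have h := mem_Ioo_floorCeil u
  have h1 : ((floorCeil u : ℤ) : ℝ) < ((c + 2 : ℤ) : ℝ) := by
    push_cast; linarith [h.1, hu.2]
  have h2 : ((c : ℤ) : ℝ) < ((floorCeil u + 2 : ℤ) : ℝ) := by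
    push_cast; linarith [h.2, hu.1]
  rw [Int.cast_lt] at h1 h2
  rw [Int.even_iff, Int.even_iff] at hpar
  omega

theorem eventually_floorCeil_eq {u : ℝ} (h : ¬ Even (floorCeil u)) :
    ∀ᶠ v in nhds u, floorCeil v = floorCeil u := by
  rcases floorCeil_cases u with ⟨j, hj, h'⟩ | ⟨j, h1, h2, h'⟩
  · rw [h'] at h; simp at h
  · filter_upwards [Ioo_mem_nhds h1 h2] with v hv
    rw [h', floorCeil_of_mem_Ioo hv.1 hv.2]

/-- The projection `ℝⁿ → Tⁿ`. -/
def torusProj {n : ℕ} (x : Fin n → ℝ) : Torus n := fun i => (x i : AddCircle (1 : ℝ))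

theorem torusProj_surjective {n : ℕ} : Function.Surjective (torusProj (n := n)) := by
  intro y
  choose x hx using fun i => QuotientAddGroup.mk_surjective (y i)
  exact ⟨x, funext hx⟩

theorem continuous_torusProj {n : ℕ} : Continuous (torusProj (n := n)) :=
  continuous_pi fun i => (AddCircle.continuous_mk' 1).comp (continuous_apply i)

theorem isOpenMap_torusProj {n : ℕ} : IsOpenMap (torusProj (n := n)) :=
  IsOpenMap.piMap (f := fun _ : Fin n => ((↑) : ℝ → AddCircle (1 : ℝ)))
    (fun _ => QuotientAddGroup.isOpenMap_coe)
    (Filter.Eventually.of_forall fun _ => QuotientAddGroup.mk_surjective)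

theorem coe_addCircle_eq_iff {x y : ℝ} :
    (x : AddCircle (1 : ℝ)) = y ↔ ∃ v : ℤ, y = x + v := by
  rw [eq_comm, ← sub_eq_zero, ← AddCircle.coe_sub, AddCircle.coe_eq_zero_iff]
  simp only [zsmul_eq_mul, mul_one]
  exact exists_congr fun v => ⟨fun h => by linarith, fun h => by linarith⟩

theorem torusProj_eq_iff {n : ℕ} {x y : Fin n → ℝ} :
    torusProj x = torusProj y ↔ ∃ v : Fin n → ℤ, y = fun i => x i + v i := by
  constructor
  · intro h
    choose v hv using fun i => coe_addCircle_eq_iff.1 (congrFun h i)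
    exact ⟨v, funext hv⟩
  · rintro ⟨v, rfl⟩
    exact funext fun i => coe_addCircle_eq_iff.2 ⟨v i, rfl⟩

/-- The real linear form with integer coefficient vector `a`. -/
def intForm {n : ℕ} (a : Fin n → ℤ) : (Fin n → ℝ) →ₗ[ℝ] ℝ where
  toFun x := ∑ j, (a j : ℝ) * x j
  map_add' x y := by simp [mul_add, Finset.sum_add_distrib]
  map_smul' c x := by simp [Finset.mul_sum, mul_left_comm]

theorem intForm_apply {n : ℕ} (a : Fin n → ℤ) (x : Fin n → ℝ) :
    intForm a x = ∑ j, (a j : ℝ) * x j := rfl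

theorem continuous_intForm {n : ℕ} (a : Fin n → ℤ) : Continuous (intForm a) := by
  simp only [funext (intForm_apply a)]
  fun_prop

theorem theta_torusProj {n : ℕ} (a : Fin n → ℤ) (x : Fin n → ℝ) :
    theta a (torusProj x) = (intForm a x : AddCircle (1 : ℝ)) := by
  rw [theta, intForm_apply]
  have : ((∑ j, (a j : ℝ) * x j : ℝ) : AddCircle (1 : ℝ)) =
      ∑ j, (((a j : ℝ) * x j : ℝ) : AddCircle (1 : ℝ)) :=
    map_sum (QuotientAddGroup.mk' (AddSubgroup.zmultiples (1 : ℝ))) _ _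
  rw [this]
  refine Finset.sum_congr rfl fun j _ => ?_
  rw [← zsmul_eq_mul, AddCircle.coe_zsmul]
  rfl

theorem continuous_theta {n : ℕ} (a : Fin n → ℤ) : Continuous (theta a) := by
  unfold theta
  fun_prop

theorem isClosed_Hyp {n : ℕ} (a : Fin n → ℤ) (c : AddCircle (1 : ℝ)) : IsClosed (Hyp a c) :=
  isClosed_eq (continuous_theta a) continuous_const

/-- The number of hyperplanes containing the points with position `c`. -/
def evenCount {ι : Type*} [Fintype ι] (c : ι → ℤ) : ℕ :=
  (Finset.univ.filter fun i => Even (c i)).card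

section Cells

variable {n : ℕ} {ι : Type*} (a : ι → Fin n → ℤ) (β : ι → ℝ)

/-- The combinatorial position of a point of `ℝⁿ` with respect to the periodic arrangement of
the hyperplanes `a i · x ∈ β i + ℤ`. -/
noncomputable def position (x : Fin n → ℝ) (i : ι) : ℤ :=
  floorCeil (intForm (a i) x - β i)

/-- The image in the torus of the set of points with a given position. -/
def cell (c : ι → ℤ) : Set (Torus n) := torusProj '' {x | position a β x = c}

/-- The hyperplanes of the toric arrangement with normal vectors `a i` and intercepts `β i`. -/
abbrev hyps (i : ι) : Set (Torus n) := Hyp (a i) (β i : AddCircle (1 : ℝ))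

variable {a β}

theorem torusProj_mem_hyps {x : Fin n → ℝ} {i : ι} :
    torusProj x ∈ hyps a β i ↔ Even (position a β x i) := by
  rw [position, even_floorCeil, hyps, Hyp, mem_ofPred_eq, theta_torusProj, eq_comm,
    coe_addCircle_eq_iff]
  exact exists_congr fun v => ⟨fun h => by linarith, fun h => by linarith⟩

theorem intForm_add_int (b : Fin n → ℤ) (x : Fin n → ℝ) (v : Fin n → ℤ) :
    intForm b (fun i => x i + v i) = intForm b x + ((∑ j, b j * v j : ℤ) : ℝ) := by
  simp [intForm_apply, mul_add, Finset.sum_add_distrib]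

theorem position_add_int (x : Fin n → ℝ) (v : Fin n → ℤ) (i : ι) :
    position a β (fun j => x j + v j) i = position a β x i + 2 * ∑ j, a i j * v j := by
  rw [position, position, intForm_add_int, ← floorCeil_add_intCast]
  congr 1; ring

theorem cell_eq_of_eq_add {c d : ι → ℤ} {v : Fin n → ℤ}
    (h : ∀ i, d i = c i + 2 * ∑ j, a i j * v j) : cell a β c = cell a β d := by
  have key : ∀ {c d : ι → ℤ} {v : Fin n → ℤ},
      (∀ i, d i = c i + 2 * ∑ j, a i j * v j) → cell a β c ⊆ cell a β d := by
    rintro c d v h _ ⟨x, rfl, rfl⟩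
    refine ⟨fun j => x j + v j, ?_, (torusProj_eq_iff.2 ⟨v, rfl⟩).symm⟩
    funext i
    rw [position_add_int, h]
  refine (key h).antisymm (key (v := -v) fun i => ?_)
  rw [h]; simp

theorem exists_eq_add_of_mem_cell {c d : ι → ℤ} {y : Torus n} (hc : y ∈ cell a β c)
    (hd : y ∈ cell a β d) : ∃ v : Fin n → ℤ, ∀ i, d i = c i + 2 * ∑ j, a i j * v j := by
  obtain ⟨x, rfl, rfl⟩ := hc
  obtain ⟨x', rfl, hx'⟩ := hd
  obtain ⟨v, rfl⟩ := torusProj_eq_iff.1 hx'.symm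
  exact ⟨v, fun i => position_add_int x v i⟩

theorem mem_cell (x : Fin n → ℝ) : torusProj x ∈ cell a β (position a β x) := ⟨x, rfl, rfl⟩

theorem cell_eq_iff {c d : ι → ℤ} (hc : c ∈ range (position a β)) :
    cell a β c = cell a β d ↔ ∃ v : Fin n → ℤ, ∀ i, d i = c i + 2 * ∑ j, a i j * v j := by
  refine ⟨fun h => ?_, fun ⟨v, h⟩ => cell_eq_of_eq_add h⟩
  obtain ⟨x, rfl⟩ := hc
  exact exists_eq_add_of_mem_cell (mem_cell x) (h ▸ mem_cell x)

theorem add_mem_range_position {c d : ι → ℤ} (hc : c ∈ range (position a β)) {v : Fin n → ℤ}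
    (h : ∀ i, d i = c i + 2 * ∑ j, a i j * v j) : d ∈ range (position a β) := by
  obtain ⟨x, rfl⟩ := hc
  exact ⟨fun j => x j + v j, funext fun i => by rw [position_add_int, h]⟩

theorem convex_position_eq (c : ι → ℤ) : Convex ℝ {x | position a β x = c} := by
  have : {x | position a β x = c} =
      ⋂ i, (fun x => intForm (a i) x) ⁻¹' ((fun t => t + -β i) ⁻¹' (floorCeil ⁻¹' {c i})) := by
    ext x
    simp [funext_iff, position, sub_eq_add_neg]
  rw [this]
  refine convex_iInter fun i => Convex.linear_preimage (OrdConnected.convex ?_) (intForm (a i))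
  exact (ordConnected_singleton.preimage_mono floorCeil_mono).preimage_mono
    (fun _ _ h => by simpa using h)

variable [Fintype ι]

theorem incid_torusProj_eq_iff {x y : Fin n → ℝ} :
    incid (hyps a β) (torusProj x) = incid (hyps a β) (torusProj y) ↔
      ∀ i, Even (position a β x i) ↔ Even (position a β y i) := by
  simp only [Finset.ext_iff, mem_incid, torusProj_mem_hyps]

theorem card_incid_torusProj (x : Fin n → ℝ) :
    (incid (hyps a β) (torusProj x)).card =
      evenCount (position a β x) := by
  unfold evenCount
  congr 1
  ext i
  simp [mem_incid, torusProj_mem_hyps]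

/-- The strata of a toric arrangement are decomposed into components by the cells. -/
theorem connectedComponentIn_eq_cell (x : Fin n → ℝ) :
    connectedComponentIn {y | incid (hyps a β) y = incid (hyps a β) (torusProj x)}
      (torusProj x) = cell a β (position a β x) := by
  set F := {y | incid (hyps a β) y = incid (hyps a β) (torusProj x)}
  let O : (ι → ℤ) → Set (Fin n → ℝ) := fun c =>
    {z | ∀ i, intForm (a i) z - β i ∈ Ioo (((c i : ℝ) - 1) / 2) (((c i : ℝ) + 1) / 2)}
  have hO : ∀ c, IsOpen (torusProj '' O c) := fun c => by
    refine isOpenMap_torusProj _ ?_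
    simp only [O, ofPred_forall]
    exact isOpen_iInter_of_finite fun i =>
      isOpen_Ioo.preimage ((continuous_intForm (a i)).sub continuous_const)
  have hpos : ∀ z, z ∈ O (position a β z) := fun z i => mem_Ioo_floorCeil _
  have hcell : ∀ z, torusProj z ∈ F → ∀ y ∈ F, y ∈ torusProj '' O (position a β z) →
      y ∈ cell a β (position a β z) := by
    rintro z hz _ hy ⟨w, hw, rfl⟩
    refine ⟨w, funext fun i => floorCeil_eq_of_mem_Ioo (hw i) ?_, rfl⟩
    exact incid_torusProj_eq_iff.1 (hy.trans hz.symm) i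
  have hxF : torusProj x ∈ F := rfl
  apply Subset.antisymm
  · let V : Set (Torus n) := ⋃ z ∈ {z | torusProj z ∈ F ∧
      Disjoint (cell a β (position a β z)) (cell a β (position a β x))},
      torusProj '' O (position a β z)
    have hV : IsOpen V := isOpen_biUnion fun z _ => hO _
    have hsub := connectedComponentIn_subset F (torusProj x)
    have hdisj : ∀ y ∈ F, y ∈ V → y ∉ cell a β (position a β x) := by
      intro y hy hyV hyc
      simp only [V, mem_iUnion, exists_prop] at hyV
      obtain ⟨z, ⟨hz, hd⟩, hyz⟩ := hyV
      exact disjoint_left.1 hd (hcell z hz y hy hyz) hyc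
    rcases isPreconnected_iff_subset_of_disjoint.1
      (isPreconnected_connectedComponentIn (F := F) (x := torusProj x)) _ V
      (hO (position a β x)) hV
      (by
        intro y hy
        obtain ⟨z, rfl⟩ := torusProj_surjective y
        by_cases h : Disjoint (cell a β (position a β z)) (cell a β (position a β x))
        · exact Or.inr (mem_biUnion (x := z) ⟨hsub hy, h⟩ ⟨z, hpos z, rfl⟩)
        · rw [not_disjoint_iff] at h
          obtain ⟨w, hw1, hw2⟩ := h
          obtain ⟨v, hv⟩ := exists_eq_add_of_mem_cell hw1 hw2
          have := mem_cell (a := a) (β := β) z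
          rw [cell_eq_of_eq_add hv] at this
          obtain ⟨w', hw', hw''⟩ := this
          rw [← hw'']
          exact Or.inl ⟨w', hw' ▸ hpos w', rfl⟩)
      (by
        rw [eq_empty_iff_forall_notMem]
        rintro y ⟨hy, hy1, hy2⟩
        exact hdisj y (hsub hy) hy2 (hcell x hxF y (hsub hy) hy1)) with h | h
    · exact fun y hy => hcell x hxF y (hsub hy) (h hy)
    · exact absurd (mem_cell x) (hdisj _ hxF (h (mem_connectedComponentIn hxF)))
  · refine IsPreconnected.subset_connectedComponentIn ?_ (mem_cell x) ?_
    · exact (convex_position_eq _).isPreconnected.image _ continuous_torusProj.continuousOn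
    · rintro _ ⟨z, hz, rfl⟩
      exact incid_torusProj_eq_iff.2 fun i => by rw [hz]

theorem strataComps_univ_hyps (r : ℕ) :
    strataComps univ (hyps a β) r = cell a β '' {c ∈ range (position a β) |
      evenCount c = r} := by
  ext C
  simp only [strataComps, mem_univ, true_and, mem_ofPred_eq, mem_image]
  constructor
  · rintro ⟨y, hr, rfl⟩
    obtain ⟨x, rfl⟩ := torusProj_surjective y
    exact ⟨_, ⟨⟨x, rfl⟩, by rw [← card_incid_torusProj, hr]⟩,
      (connectedComponentIn_eq_cell x).symm⟩
  · rintro ⟨_, ⟨⟨x, rfl⟩, hr⟩, rfl⟩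
    exact ⟨torusProj x, by rw [card_incid_torusProj, hr], (connectedComponentIn_eq_cell x).symm⟩

theorem finite_cells : (cell a β '' range (position a β)).Finite := by
  classical
  let M : ι → ℤ := fun i => floorCeil (∑ j, |(a i j : ℝ)| + |β i|)
  let m : ι → ℤ := fun i => floorCeil (-(∑ j, |(a i j : ℝ)| + |β i|))
  refine ((Set.finite_Icc m M).image (cell a β)).subset ?_
  rintro _ ⟨_, ⟨x, rfl⟩, rfl⟩
  let x' : Fin n → ℝ := fun j => x j + ((-⌊x j⌋ : ℤ) : ℝ)
  have hx' : ∀ j, |x' j| ≤ 1 := fun j => by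
    rw [abs_le]
    simp only [x']
    push_cast
    constructor <;> linarith [Int.floor_le (x j), Int.lt_floor_add_one (x j)]
  refine ⟨position a β x', ?_, ?_⟩
  · have hb : ∀ i, |intForm (a i) x' - β i| ≤ ∑ j, |(a i j : ℝ)| + |β i| := fun i => by
      refine (abs_sub _ _).trans (add_le_add_left ?_ _)
      rw [intForm_apply]
      refine (Finset.abs_sum_le_sum_abs _ _).trans (Finset.sum_le_sum fun j _ => ?_)
      rw [abs_mul]
      exact mul_le_of_le_one_right (abs_nonneg _) (hx' j)
    exact ⟨fun i => floorCeil_mono (abs_le.1 (hb i)).1,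
      fun i => floorCeil_mono (abs_le.1 (hb i)).2⟩
  · exact (cell_eq_of_eq_add fun i => position_add_int x (fun j => -⌊x j⌋) i).symm

end Cells

section Counting

variable {n : ℕ} {ι : Type*} {a : ι → Fin n → ℤ} {β : ι → ℝ}

/-- Intermediate value property: along a segment that only changes the position with respect
to the hyperplane `i₀`, all intermediate positions occur. -/
theorem update_mem_range_position [DecidableEq ι] {i₀ : ι} {x y : Fin n → ℝ}
    (h : ∀ i, i ≠ i₀ → position a β x i = position a β y i) {z : ℤ}
    (h1 : position a β x i₀ ≤ z) (h2 : z ≤ position a β y i₀) :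
    Function.update (position a β x) i₀ z ∈ range (position a β) := by
  rcases h1.eq_or_lt with h1 | h1
  · exact ⟨x, by rw [← h1, Function.update_eq_self]⟩
  rcases h2.eq_or_lt with h2 | h2
  · refine ⟨y, funext fun i => ?_⟩
    rcases eq_or_ne i i₀ with rfl | hi
    · simp [h2]
    · simp [hi, h i hi]
  have hx : intForm (a i₀) x - β i₀ < (z : ℝ) / 2 := by
    by_contra hc
    have := floorCeil_mono (not_lt.1 hc)
    rw [floorCeil_half] at this
    exact absurd h1 (not_lt.2 this)
  have hy : (z : ℝ) / 2 < intForm (a i₀) y - β i₀ := by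
    by_contra hc
    have := floorCeil_mono (not_lt.1 hc)
    rw [floorCeil_half] at this
    exact absurd h2 (not_lt.2 this)
  set u := intForm (a i₀) x - β i₀ with hu
  set w := intForm (a i₀) y - β i₀ with hw
  have hwu : 0 < w - u := by linarith
  let s : ℝ := ((z : ℝ) / 2 - u) / (w - u)
  have hs0 : 0 ≤ s := div_nonneg (by linarith) hwu.le
  have hs1 : s ≤ 1 := (div_le_one hwu).2 (by linarith)
  have hsm : s * (w - u) = (z : ℝ) / 2 - u := div_mul_cancel₀ _ hwu.ne'
  have hval : ∀ i, intForm (a i) ((1 - s) • x + s • y) =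
      (1 - s) * intForm (a i) x + s * intForm (a i) y := fun i => by simp
  refine ⟨(1 - s) • x + s • y, funext fun i => ?_⟩
  rcases eq_or_ne i i₀ with rfl | hi
  · rw [Function.update_self, position, hval, ← floorCeil_half z]
    congr 1
    have : (1 - s) * intForm (a i) x + s * intForm (a i) y - β i = u + s * (w - u) := by
      rw [hu, hw]; ring
    rw [this, hsm]; ring
  · rw [Function.update_of_ne hi]
    have hconv := convex_position_eq (a := fun _ : Unit => a i) (β := fun _ => β i)
      (fun _ => position a β x i)
    have := hconv (x := x) (funext fun _ => rfl) (y := y) (funext fun _ => (h i hi).symm)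
      (sub_nonneg.2 hs1) hs0 (by ring)
    exact congrFun this ()

theorem exists_intForm_dual {S : Finset ι}
    (hli : LinearIndependent ℚ (fun i : S => fun j => (a i.1 j : ℚ))) {i₀ : ι} (hi₀ : i₀ ∈ S) :
    ∃ w : Fin n → ℝ, intForm (a i₀) w = 1 ∧ ∀ i ∈ S, i ≠ i₀ → intForm (a i) w = 0 := by
  classical
  let f₀ := (Module.Basis.span hli).constr ℚ (fun i : S => if i.1 = i₀ then (1 : ℚ) else 0)
  obtain ⟨f, hf⟩ := LinearMap.exists_extend f₀
  have hfv : ∀ i : S, f (fun j => (a i.1 j : ℚ)) = if i.1 = i₀ then (1 : ℚ) else 0 := by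
    intro i
    have h1 : f₀ (Module.Basis.span hli i) = if i.1 = i₀ then (1 : ℚ) else 0 :=
      Module.Basis.constr_basis _ _ _ _
    rw [← h1, ← hf, LinearMap.comp_apply, Submodule.subtype_apply, Module.Basis.span_apply]
  let w : Fin n → ℝ := fun j => ((f (Pi.single j 1) : ℚ) : ℝ)
  have hw : ∀ i : S, intForm (a i.1) w = ((if i.1 = i₀ then (1 : ℚ) else 0 : ℚ) : ℝ) := by
    intro i
    rw [← hfv i, LinearMap.pi_apply_eq_sum_univ f, intForm_apply]
    push_cast
    refine Finset.sum_congr rfl fun j _ => ?_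
    simp [w]
    left
    congr 2
    funext j'
    simp [Pi.single_apply, eq_comm]
  exact ⟨w, by simpa using hw ⟨i₀, hi₀⟩, fun i hi hne => by simpa [hne] using hw ⟨i, hi⟩⟩

/-- A point on a hyperplane in general position can be moved off to both sides without
changing its position with respect to the other hyperplanes. -/
theorem update_wall_mem_range_position [Finite ι] [DecidableEq ι] {S : Finset ι}
    {x : Fin n → ℝ} (hS : ∀ i, Even (position a β x i) → i ∈ S)
    (hli : LinearIndependent ℚ (fun i : S => fun j => (a i.1 j : ℚ))) {i₀ : ι}
    (hi₀ : Even (position a β x i₀)) :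
    Function.update (position a β x) i₀ (position a β x i₀ + 1) ∈ range (position a β) ∧
      Function.update (position a β x) i₀ (position a β x i₀ - 1) ∈ range (position a β) := by
  obtain ⟨w, hw1, hw0⟩ := exists_intForm_dual hli (hS i₀ hi₀)
  have hev : ∀ᶠ t : ℝ in nhds 0, ∀ i, i ≠ i₀ →
      position a β (x + t • w) i = position a β x i := by
    rw [Filter.eventually_all]
    intro i
    by_cases hi : i = i₀
    · exact Filter.Eventually.of_forall fun t h => absurd hi h
    by_cases he : Even (position a β x i)
    · refine Filter.Eventually.of_forall fun t _ => ?_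
      simp [position, hw0 i (hS i he) hi]
    · have hc : Filter.Tendsto (fun t : ℝ => intForm (a i) (x + t • w) - β i) (nhds 0)
          (nhds (intForm (a i) x - β i)) := by
        have : Continuous fun t : ℝ => intForm (a i) (x + t • w) - β i := by
          simp only [map_add, map_smul]
          fun_prop
        simpa using this.tendsto 0
      filter_upwards [hc.eventually (eventually_floorCeil_eq he)] with t ht _
      exact ht
  obtain ⟨j, hj⟩ := even_floorCeil.1 hi₀
  obtain ⟨ε, hε, hball⟩ := Metric.eventually_nhds_iff.1 hev
  let t := min (ε / 2) (1 / 2)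
  have ht0 : 0 < t := lt_min (by linarith) (by norm_num)
  have htε : t < ε := (min_le_left _ _).trans_lt (by linarith)
  have ht1 : t < 1 := (min_le_right _ _).trans_lt (by norm_num)
  have hpos : position a β x i₀ = 2 * j := by rw [position, hj, floorCeil_intCast]
  have hval : ∀ t : ℝ, intForm (a i₀) (x + t • w) - β i₀ = j + t := fun t => by
    rw [← hj, map_add, map_smul, hw1, smul_eq_mul]; ring
  constructor
  · refine ⟨x + t • w, funext fun i => ?_⟩
    rcases eq_or_ne i i₀ with rfl | hi
    · rw [Function.update_self, hpos, position, hval,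
        floorCeil_of_mem_Ioo (j := j) (by linarith) (by linarith)]
    · rw [Function.update_of_ne hi]
      exact hball (by simpa [abs_of_pos ht0] using htε) i hi
  · refine ⟨x + (-t) • w, funext fun i => ?_⟩
    rcases eq_or_ne i i₀ with rfl | hi
    · rw [Function.update_self, hpos, position, hval,
        floorCeil_of_mem_Ioo (j := j - 1) (by push_cast; linarith) (by push_cast; linarith)]
      ring
    · rw [Function.update_of_ne hi]
      exact hball (by simpa [abs_of_pos ht0] using htε) i hi

/-- If the hyperplanes other than `i₀` are spanning, the position with respect to `i₀` is bounded
on each of their cells. -/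
theorem exists_position_le [Fintype ι] {κ : Type*} {b : κ → Fin n → ℤ} {γ : κ → ℝ}
    [Fintype κ] (hspan : Spanning b) (i₀ : ι) (c : κ → ℤ) :
    ∃ M : ℤ, ∀ x, position b γ x = c → position a β x i₀ ≤ M := by
  obtain ⟨s, hs, hli⟩ := hspan
  have htop := hli.span_eq_top_of_card_eq_finrank' (by simp [hs])
  have hmem : (fun j => (a i₀ j : ℚ)) ∈ Submodule.span ℚ
      (range fun (i : s) => fun j => (b i.1 j : ℚ)) := htop ▸ Submodule.mem_top
  obtain ⟨q, hq⟩ := (Submodule.mem_span_range_iff_exists_fun ℚ).1 hmem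
  have hform : ∀ x, intForm (a i₀) x = ∑ i : s, (q i : ℝ) * intForm (b i.1) x := by
    intro x
    simp only [intForm_apply, Finset.mul_sum]
    rw [Finset.sum_comm]
    refine Finset.sum_congr rfl fun j _ => ?_
    have := congrFun hq j
    simp only [Finset.sum_apply, Pi.smul_apply, smul_eq_mul] at this
    have h2 : ((a i₀ j : ℚ) : ℝ) = ((∑ i : s, q i * (b i.1 j : ℚ) : ℚ) : ℝ) := by rw [this]
    push_cast at h2
    rw [h2, Finset.sum_mul]
    exact Finset.sum_congr rfl fun i _ => by ring
  refine ⟨floorCeil (∑ i : s, |(q i : ℝ)| * (|((c i.1 : ℝ) - 1) / 2| +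
    |((c i.1 : ℝ) + 1) / 2| + |γ i.1|) - β i₀), fun x hx => ?_⟩
  refine floorCeil_mono (sub_le_sub_right ?_ _)
  rw [hform]
  refine Finset.sum_le_sum fun i _ => (le_abs_self _).trans ?_
  rw [abs_mul]
  refine mul_le_mul_of_nonneg_left ?_ (abs_nonneg _)
  have hi := mem_Ioo_floorCeil (intForm (b i.1) x - γ i.1)
  have hc : floorCeil (intForm (b i.1) x - γ i.1) = c i.1 := congrFun hx i.1
  rw [hc] at hi
  rw [abs_le]
  constructor
  · linarith [hi.1, neg_abs_le (((c i.1 : ℝ) - 1) / 2), abs_nonneg (((c i.1 : ℝ) + 1) / 2),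
      neg_abs_le (γ i.1)]
  · linarith [hi.2, le_abs_self (((c i.1 : ℝ) + 1) / 2), abs_nonneg (((c i.1 : ℝ) - 1) / 2),
      le_abs_self (γ i.1)]

end Counting

theorem Set.ncard_image_eq_ncard_image {A B X Y : Type*} {p : A → X} {q : B → Y} {D : Set A}
    {E : Set B} (f : A → B) (hmaps : MapsTo f D E) (hsurj : ∀ e ∈ E, ∃ d ∈ D, q (f d) = q e)
    (hiff : ∀ c ∈ D, ∀ d ∈ D, p c = p d ↔ q (f c) = q (f d)) :
    (p '' D).ncard = (q '' E).ncard := by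
  choose g hgD hgp using fun (y : X) (hy : y ∈ p '' D) => hy
  refine Set.ncard_congr (fun y hy => q (f (g y hy))) (fun y hy => ?_) (fun y z hy hz h => ?_)
    (fun y hy => ?_)
  · exact ⟨_, hmaps (hgD y hy), rfl⟩
  · rw [← hgp y hy, ← hgp z hz]
    exact (hiff _ (hgD y hy) _ (hgD z hz)).2 h
  · obtain ⟨e, he, rfl⟩ := hy
    obtain ⟨d, hd, hde⟩ := hsurj e he
    have hpd : p d ∈ p '' D := ⟨d, hd, rfl⟩
    refine ⟨p d, hpd, ?_⟩
    rw [← hde]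
    exact (hiff _ (hgD _ hpd) _ hd).1 (hgp _ hpd)

theorem evenCount_eq_add_ne {ι : Type*} [Fintype ι] [DecidableEq ι] (i₀ : ι) (c : ι → ℤ) :
    evenCount c = (if Even (c i₀) then 1 else 0) +
      evenCount (fun i : {i : ι // i ≠ i₀} => c i.1) := by
  simp only [evenCount, Finset.card_filter]
  exact Fintype.sum_eq_add_sum_subtype_ne _ i₀

/-- A point of `H i₀` lies on `H i₀` and on the members of the restriction to `H i₀` containing
it. -/
theorem incid_eq_insert_map {X ι : Type*} [Fintype ι] {H : ι → Set X} {i₀ : ι}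
    [Fintype {i : ι // i ≠ i₀ ∧ (H i₀ ∩ H i).Nonempty}] {x : X} (hx : x ∈ H i₀) :
    incid H x = Finset.cons i₀ ((incid
      (fun i : {i : ι // i ≠ i₀ ∧ (H i₀ ∩ H i).Nonempty} => H i₀ ∩ H i.1) x).map
        (Function.Embedding.subtype _)) (by simp) := by
  ext i
  simp only [mem_incid, Finset.mem_cons, Finset.mem_map, Function.Embedding.subtype_apply]
  constructor
  · intro h
    by_cases hi : i = i₀
    · exact Or.inl hi
    · exact Or.inr ⟨⟨i, hi, x, hx, h⟩, ⟨hx, h⟩, rfl⟩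
  · rintro (rfl | ⟨j, hj, rfl⟩)
    · exact hx
    · exact hj.2

section DeletionRestriction

variable {n : ℕ} {ι : Type*} [Fintype ι] [DecidableEq ι] {a : ι → Fin n → ℤ} {β : ι → ℝ}

/-- Deletion-restriction for positions: the cells off the hyperplane `i₀` correspond to the
cells of the deletion together with the walls on `i₀` separating two of them. -/
theorem ncard_cells_eq (i₀ : ι)
    (hspan : Spanning (fun i : {i : ι // i ≠ i₀} => a i.1))
    (hli : ∀ x, LinearIndependent ℚ
      (fun i : incid (hyps a β) (torusProj x) => fun j => (a i.1 j : ℚ))) (r : ℕ) :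
    (cell a β '' {c ∈ range (position a β) | evenCount c = r}).ncard =
      (cell (fun i : {i : ι // i ≠ i₀} => a i.1) (fun i => β i.1) ''
        {c ∈ range (position (fun i : {i : ι // i ≠ i₀} => a i.1) (fun i => β i.1)) |
          evenCount c = r}).ncard +
      (cell a β '' {c ∈ range (position a β) | Even (c i₀) ∧ evenCount c = r}).ncard +
      (cell a β '' {c ∈ range (position a β) | Even (c i₀) ∧ evenCount c = r + 1}).ncard := by
  set R := range (position a β) with hR
  let sh : ℤ → (ι → ℤ) → ι → ℤ := fun z c => Function.update c i₀ (c i₀ + z)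
  have sh_self : ∀ z c, sh z c i₀ = c i₀ + z := fun z c => by simp [sh]
  have sh_ne : ∀ z c i, i ≠ i₀ → sh z c i = c i := fun z c i hi => by simp [sh, hi]
  have sh_sh : ∀ z w c, sh z (sh w c) = sh (w + z) c := fun z w c => by
    simp [sh, add_assoc]
  have sh_zero : ∀ c, sh 0 c = c := fun c => by simp [sh]
  have sh_rel : ∀ z c d (v : Fin n → ℤ), (∀ i, d i = c i + 2 * ∑ j, a i j * v j) →
      ∀ i, sh z d i = sh z c i + 2 * ∑ j, a i j * v j := by
    intro z c d v h i
    rcases eq_or_ne i i₀ with rfl | hi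
    · rw [sh_self, sh_self, h]; ring
    · rw [sh_ne z d i hi, sh_ne z c i hi, h]
  have sh_count : ∀ z c, evenCount (sh z c) = (if Even (c i₀ + z) then 1 else 0) +
      evenCount (fun i : {i : ι // i ≠ i₀} => c i.1) := by
    intro z c
    rw [evenCount_eq_add_ne i₀, sh_self]
    congr 2
    funext i
    exact sh_ne z c i.1 i.2
  have wall : ∀ c ∈ R, Even (c i₀) → sh 1 c ∈ R ∧ sh (-1) c ∈ R := by
    rintro _ ⟨x, rfl⟩ he
    exact update_wall_mem_range_position
      (fun i hi => mem_incid.2 (torusProj_mem_hyps.2 hi)) (hli x) he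
  have ivt : ∀ c ∈ R, ∀ w, sh w c ∈ R → ∀ z, 0 ≤ z → z ≤ w → sh z c ∈ R := by
    rintro _ ⟨x, rfl⟩ w ⟨y, hy⟩ z hz hzw
    refine update_mem_range_position (y := y) (fun i hi => ?_) (by linarith) ?_
    · rw [hy, sh_ne _ _ _ hi]
    · rw [hy, sh_self]; linarith
  -- `T` consists of the topmost cells off `i₀`, `N` of the other ones
  set E : Set (ι → ℤ) := {c ∈ R | Even (c i₀) ∧ evenCount c = r} with hE
  set W : Set (ι → ℤ) := {c ∈ R | Even (c i₀) ∧ evenCount c = r + 1} with hW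
  let T : Set (ι → ℤ) := {c ∈ R | (¬ Even (c i₀) ∧ evenCount c = r) ∧ sh 2 c ∉ R}
  let N : Set (ι → ℤ) := {c ∈ R | (¬ Even (c i₀) ∧ evenCount c = r) ∧ sh 2 c ∈ R}
  have hfin : ∀ D ⊆ R, (cell a β '' D).Finite := fun D hD =>
    finite_cells.subset (image_mono hD)
  have hunion : {c ∈ R | evenCount c = r} = (T ∪ E) ∪ N := by
    ext c
    simp only [T, N, hE, mem_union, mem_ofPred_eq]
    tauto
  have hdisj1 : Disjoint (cell a β '' T) (cell a β '' E) := by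
    rw [disjoint_left]
    rintro _ ⟨c, hc, rfl⟩ ⟨d, hd, hcd⟩
    obtain ⟨v, hv⟩ := (cell_eq_iff hd.1).1 hcd
    refine hc.2.1.1 ?_
    rw [hv]
    exact hd.2.1.add (even_two_mul _)
  have hdisj2 : Disjoint (cell a β '' (T ∪ E)) (cell a β '' N) := by
    rw [disjoint_left]
    rintro _ ⟨c, hc, rfl⟩ ⟨d, hd, hcd⟩
    obtain ⟨v, hv⟩ := (cell_eq_iff hd.1).1 hcd
    rcases hc with hc | hc
    · exact hc.2.2 (add_mem_range_position hd.2.2 (sh_rel 2 _ _ v hv))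
    · have := hc.2.1
      rw [hv, Int.even_add] at this
      exact hd.2.1.1 (this.2 (even_two_mul _))
  have hTsub : T ⊆ R := fun c hc => hc.1
  have hNsub : N ⊆ R := fun c hc => hc.1
  have hEsub : E ⊆ R := fun c hc => hc.1
  rw [hunion, image_union, ncard_union_eq hdisj2 (hfin _ (union_subset hTsub hEsub))
    (hfin _ hNsub), image_union, ncard_union_eq hdisj1 (hfin _ hTsub) (hfin _ hEsub)]
  refine congrArg₂ _ (congrArg₂ _ ?_ rfl) ?_
  · refine Set.ncard_image_eq_ncard_image (fun c i => c i.1) ?_ ?_ ?_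
    · rintro c ⟨⟨x, rfl⟩, ⟨hodd, hcount⟩, -⟩
      refine ⟨⟨x, rfl⟩, ?_⟩
      rw [evenCount_eq_add_ne i₀, if_neg hodd, zero_add] at hcount
      exact hcount
    · rintro _ ⟨⟨x, rfl⟩, hcount⟩
      obtain ⟨M, hM⟩ := exists_position_le (a := a) (β := β) (γ := fun i => β i.1) hspan i₀
        (position (fun i : {i : ι // i ≠ i₀} => a i.1) (fun i => β i.1) x)
      obtain ⟨t, ⟨ht, htmax⟩⟩ := Int.exists_greatest_of_bdd
        (P := fun t => sh t (position a β x) ∈ R)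
        ⟨M - position a β x i₀, by
          rintro t ⟨y, hy⟩
          have h1 := hM y (funext fun i => by
            have := congrFun hy i.1
            rw [sh_ne _ _ _ i.2] at this
            exact this)
          rw [hy, sh_self] at h1
          linarith⟩ ⟨0, by rw [sh_zero]; exact ⟨x, rfl⟩⟩
      have hodd : ¬ Even (position a β x i₀ + t) := by
        intro he
        have := (wall _ ht (by rwa [sh_self])).1
        rw [sh_sh] at this
        have := htmax _ this
        linarith
      refine ⟨_, ⟨ht, ⟨by rwa [sh_self], ?_⟩, ?_⟩, ?_⟩
      · rw [sh_count, if_neg hodd, zero_add]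
        exact hcount
      · rw [sh_sh]
        intro h
        have := htmax _ h
        linarith
      · congr 1
        funext i
        exact sh_ne _ _ _ i.2
    · rintro c hc d hd
      have hc' : (fun i : {i : ι // i ≠ i₀} => c i.1) ∈
          range (position (fun i : {i : ι // i ≠ i₀} => a i.1) (fun i => β i.1)) := by
        obtain ⟨x, rfl⟩ := hc.1
        exact ⟨x, rfl⟩
      rw [cell_eq_iff hc.1, cell_eq_iff hc']
      refine exists_congr fun v => ⟨fun h i => h i.1, fun h => ?_⟩
      set c' : ι → ℤ := fun i => c i + 2 * ∑ j, a i j * v j with hc'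
      have hc'R : c' ∈ R := add_mem_range_position hc.1 (v := v) fun i => rfl
      have hc'top : sh 2 c' ∉ R := fun h => hc.2.2
        (add_mem_range_position (v := -v) h (sh_rel 2 _ _ _ fun i => by simp [hc']))
      have hc'odd : ¬ Even (c' i₀) := by
        rw [hc', Int.even_add]
        have := hc.2.1.1
        simp [this]
      have hdc : d = sh (d i₀ - c' i₀) c' := by
        funext i
        rcases eq_or_ne i i₀ with rfl | hi
        · rw [sh_self]; ring
        · rw [sh_ne _ _ _ hi]; exact h ⟨i, hi⟩
      have hcd : c' = sh (c' i₀ - d i₀) d := by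
        rw [hdc, sh_sh, sh_self]
        conv_lhs => rw [← sh_zero c']
        congr 1
        ring
      have hdodd := hd.2.1.1
      have heq : d i₀ = c' i₀ := by
        rw [Int.not_even_iff] at hdodd hc'odd
        by_contra hne
        rcases lt_or_gt_of_ne hne with hlt | hlt
        · exact hd.2.2 (ivt d hd.1 _ (hcd ▸ hc'R) 2 (by norm_num) (by omega))
        · exact hc'top (ivt c' hc'R _ (hdc ▸ hd.1) 2 (by norm_num) (by omega))
      intro i
      rw [heq, sub_self, sh_zero] at hdc
      rw [hdc]
  · refine Set.ncard_image_eq_ncard_image (sh 1) ?_ ?_ ?_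
    · rintro c ⟨hcR, ⟨hodd, hcount⟩, htop⟩
      have heven : Even (c i₀ + 1) := by
        rw [Int.even_add_one]; exact hodd
      refine ⟨ivt c hcR 2 htop 1 (by norm_num) (by norm_num), by rwa [sh_self], ?_⟩
      rw [evenCount_eq_add_ne i₀, if_neg hodd] at hcount
      rw [sh_count, if_pos heven]
      omega
    · rintro c ⟨hcR, heven, hcount⟩
      have hodd : ¬ Even (c i₀ + -1) := by
        rw [Int.even_add]; simp [heven]
      obtain ⟨hp, hm⟩ := wall c hcR heven
      refine ⟨sh (-1) c, ⟨hm, ⟨by rwa [sh_self], ?_⟩, ?_⟩, ?_⟩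
      · rw [sh_count, if_neg hodd]
        rw [evenCount_eq_add_ne i₀, if_pos heven] at hcount
        omega
      · rw [sh_sh]; exact hp
      · rw [sh_sh, neg_add_cancel, sh_zero]
    · rintro c hc d hd
      rw [cell_eq_iff hc.1, cell_eq_iff (ivt c hc.1 2 hc.2.2 1 (by norm_num) (by norm_num))]
      refine exists_congr fun v => ⟨sh_rel 1 c d v, fun h i => ?_⟩
      have := sh_rel (-1) _ _ v h i
      simpa only [sh_sh, add_neg_cancel, sh_zero] using this

omit [DecidableEq ι] in
/-- The strata of the restriction to `i₀` are those strata of the arrangement that lie on `i₀`. -/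
theorem strataComps_restriction (i₀ : ι)
    [Fintype {i : ι // i ≠ i₀ ∧ (hyps a β i₀ ∩ hyps a β i).Nonempty}] (r : ℕ) :
    strataComps (hyps a β i₀)
      (fun i : {i : ι // i ≠ i₀ ∧ (hyps a β i₀ ∩ hyps a β i).Nonempty} =>
        hyps a β i₀ ∩ hyps a β i.1) r =
      cell a β '' {c ∈ range (position a β) | Even (c i₀) ∧ evenCount c = r + 1} := by
  have hcard : ∀ {x}, x ∈ hyps a β i₀ → (incid (hyps a β) x).card = (incid
      (fun i : {i : ι // i ≠ i₀ ∧ (hyps a β i₀ ∩ hyps a β i).Nonempty} =>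
        hyps a β i₀ ∩ hyps a β i.1) x).card + 1 := fun hx => by
    rw [incid_eq_insert_map hx, Finset.card_cons, Finset.card_map]
  have hset : ∀ {x}, x ∈ hyps a β i₀ → {y ∈ hyps a β i₀ | incid
      (fun i : {i : ι // i ≠ i₀ ∧ (hyps a β i₀ ∩ hyps a β i).Nonempty} =>
        hyps a β i₀ ∩ hyps a β i.1) y = incid
      (fun i : {i : ι // i ≠ i₀ ∧ (hyps a β i₀ ∩ hyps a β i).Nonempty} =>
        hyps a β i₀ ∩ hyps a β i.1) x} =
      {y | incid (hyps a β) y = incid (hyps a β) x} := by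
    intro x hx
    ext y
    simp only [mem_ofPred_eq]
    constructor
    · rintro ⟨hy, h⟩
      simp only [incid_eq_insert_map hx, incid_eq_insert_map hy, h]
    · intro h
      have hy : y ∈ hyps a β i₀ := mem_incid.1 (h ▸ mem_incid.2 hx)
      refine ⟨hy, ?_⟩
      ext i
      simp only [mem_incid, mem_inter_iff, hx, hy, true_and]
      rw [← mem_incid (K := hyps a β), h, mem_incid]
  ext C
  simp only [strataComps, mem_ofPred_eq, mem_image]
  constructor
  · rintro ⟨y, hy, hr, rfl⟩
    obtain ⟨x, rfl⟩ := torusProj_surjective y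
    refine ⟨_, ⟨⟨x, rfl⟩, torusProj_mem_hyps.1 hy, ?_⟩, ?_⟩
    · rw [← card_incid_torusProj, hcard hy, hr]
    · rw [hset hy, connectedComponentIn_eq_cell]
  · rintro ⟨_, ⟨⟨x, rfl⟩, he, hr⟩, rfl⟩
    have hy : torusProj x ∈ hyps a β i₀ := torusProj_mem_hyps.2 he
    rw [← card_incid_torusProj, hcard hy] at hr
    exact ⟨torusProj x, hy, by omega, by rw [hset hy, connectedComponentIn_eq_cell]⟩

end DeletionRestriction

theorem GenPos.card_incid_le {ι : Type*} [Fintype ι] {n : ℕ} {a : ι → Fin n → ℤ}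
    {b : ι → AddCircle (1 : ℝ)} (h : GenPos a b) (x : Torus n) :
    (incid (fun i => Hyp (a i) (b i)) x).card ≤ n := by
  have := (h (incid (fun i => Hyp (a i) (b i)) x)
    ⟨x, mem_iInter₂.2 fun i hi =>
      mem_incid (K := fun i => Hyp (a i) (b i)).1 hi⟩).fintype_card_le_finrank
  simpa using this

open scoped Classical in
/-- Generalised deletion-restriction. Let `(A, A′, A″)` be a triple of toric arrangements
on `Tⁿ` with distinguished hyperplane `H₀ = H i₀`, where `A′ = A \ {H₀}` is the deletion
and `A″ = {H₀ ∩ H : H ∈ A′, H₀ ∩ H ≠ ∅}` is the restriction (an arrangement in the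
ambient space `H₀`, of dimension `n − 1`). Assume `|A| ≥ n + 1`, that `A`, `A′`, `A″` are
spanning and in general position, and that every flat of the three arrangements is simply
connected. Then `f_k(A) = f_k(A′) + f_k(A″) + f_{k−1}(A″)` for all `0 ≤ k ≤ n`, with the
conventions `f_{−1}(A″) = 0` and `f_n(A″) = 0`. -/
theorem generalized_deletion_restriction {n m : ℕ}
    (a : Fin m → Fin n → ℤ) (b : Fin m → AddCircle (1 : ℝ)) (i₀ : Fin m)
    (ha : ∀ i, a i ≠ 0) (hm : n + 1 ≤ m)
    -- A is spanning and in general position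
    (hspanA : Spanning a) (hgpA : GenPos a b)
    -- the deletion A′ is spanning and in general position
    (hspanA' : Spanning (fun i : {i : Fin m // i ≠ i₀} => a i.1))
    (hgpA' : GenPos (fun i : {i : Fin m // i ≠ i₀} => a i.1)
      (fun i : {i : Fin m // i ≠ i₀} => b i.1))
    -- the restriction A″ is spanning (inside H₀)...
    (hspanA'' : ∃ S : Finset
        {i : Fin m // i ≠ i₀ ∧ (Hyp (a i₀) (b i₀) ∩ Hyp (a i) (b i)).Nonempty},
      S.card = n - 1 ∧
        (⋂ i ∈ S, (Hyp (a i₀) (b i₀) ∩ Hyp (a i.1) (b i.1))).Nonempty)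
    -- ... and in general position (inside H₀)
    (hgpA'' : ∀ S : Finset
        {i : Fin m // i ≠ i₀ ∧ (Hyp (a i₀) (b i₀) ∩ Hyp (a i) (b i)).Nonempty},
      (⋂ i ∈ S, (Hyp (a i₀) (b i₀) ∩ Hyp (a i.1) (b i.1))).Nonempty →
        LinearIndependent ℚ
          (fun i : ↥(insert i₀ (S.image Subtype.val)) => fun j => (a i.1 j : ℚ)))
    -- every flat of A, A′ and A″ is simply connected
    (hscA : ∀ k ≤ n, ∀ σ ∈ SigIn Set.univ n (fun i => Hyp (a i) (b i)) k,
      SimplyConnectedSpace ↥σ)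
    (hscA' : ∀ k ≤ n,
      ∀ σ ∈ SigIn Set.univ n (fun i : {i : Fin m // i ≠ i₀} => Hyp (a i.1) (b i.1)) k,
      SimplyConnectedSpace ↥σ)
    (hscA'' : ∀ k ≤ n - 1,
      ∀ σ ∈ SigIn (Hyp (a i₀) (b i₀)) (n - 1)
        (fun i : {i : Fin m // i ≠ i₀ ∧ (Hyp (a i₀) (b i₀) ∩ Hyp (a i) (b i)).Nonempty} =>
          Hyp (a i₀) (b i₀) ∩ Hyp (a i.1) (b i.1)) k,
      SimplyConnectedSpace ↥σ) :
    ∀ k ≤ n,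
      Nat.card ↥(SigIn Set.univ n (fun i => Hyp (a i) (b i)) k) =
        Nat.card ↥(SigIn Set.univ n
            (fun i : {i : Fin m // i ≠ i₀} => Hyp (a i.1) (b i.1)) k) +
        (if k < n then
          Nat.card ↥(SigIn (Hyp (a i₀) (b i₀)) (n - 1)
            (fun i : {i : Fin m // i ≠ i₀ ∧
                (Hyp (a i₀) (b i₀) ∩ Hyp (a i) (b i)).Nonempty} =>
              Hyp (a i₀) (b i₀) ∩ Hyp (a i.1) (b i.1)) k)
          else 0) +
        (if k = 0 then 0 else
          Nat.card ↥(SigIn (Hyp (a i₀) (b i₀)) (n - 1)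
            (fun i : {i : Fin m // i ≠ i₀ ∧
                (Hyp (a i₀) (b i₀) ∩ Hyp (a i) (b i)).Nonempty} =>
              Hyp (a i₀) (b i₀) ∩ Hyp (a i.1) (b i.1)) (k - 1))) := by
  classical
  have hn : n ≠ 0 := by
    rintro rfl
    exact ha i₀ (Subsingleton.elim _ _)
  rcases eq_or_ne n 1 with rfl | hn1
  · refine absurd ?_ not_simplyConnectedSpace_torus_one
    have hσ : (univ : Set (Torus 1)) ∈ SigIn (Hyp (a i₀) (b i₀)) (1 - 1)
        (fun i : {i : Fin m // i ≠ i₀ ∧ (Hyp (a i₀) (b i₀) ∩ Hyp (a i) (b i)).Nonempty} =>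
          Hyp (a i₀) (b i₀) ∩ Hyp (a i.1) (b i.1)) 0 := by
      rw [SigIn_eq, if_pos rfl]
      have : (⋃ S ∈ {S : Finset {i : Fin m // i ≠ i₀ ∧
          (Hyp (a i₀) (b i₀) ∩ Hyp (a i) (b i)).Nonempty} | S.card = 1 - 1},
          ⋂ i ∈ S, Hyp (a i₀) (b i₀) ∩ Hyp (a i.1) (b i.1)) = univ := by
        simp
      rw [this]
      exact ⟨0, mem_univ _, by
        rw [connectedComponentIn_univ, PreconnectedSpace.connectedComponent_eq_univ]⟩
    have := hscA'' 0 (Nat.zero_le _) _ hσ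
    exact (Homeomorph.Set.univ (Torus 1)).symm.toHomotopyEquiv.simplyConnectedSpace
  intro k hk
  obtain ⟨β, rfl⟩ : ∃ β : Fin m → ℝ, (fun i => (β i : AddCircle (1 : ℝ))) = b := by
    choose β hβ using fun i => QuotientAddGroup.mk_surjective (b i)
    exact ⟨β, funext hβ⟩
  have hA : SigIn univ n (hyps a β) k = strataComps univ (hyps a β) (n - k) :=
    SigIn_eq_strataComps (by omega) (fun _ => subset_univ _) (fun _ => isClosed_Hyp _ _)
      hgpA.card_incid_le hk
  have hA' : SigIn univ n (hyps (fun i : {i : Fin m // i ≠ i₀} => a i.1) fun i => β i.1) k =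
      strataComps univ (hyps (fun i : {i : Fin m // i ≠ i₀} => a i.1) fun i => β i.1) (n - k) :=
    SigIn_eq_strataComps (by omega) (fun _ => subset_univ _) (fun _ => isClosed_Hyp _ _)
      hgpA'.card_incid_le hk
  have hA'' : ∀ l ≤ n - 1, SigIn (hyps a β i₀) (n - 1)
      (fun i : {i : Fin m // i ≠ i₀ ∧ (hyps a β i₀ ∩ hyps a β i).Nonempty} =>
        hyps a β i₀ ∩ hyps a β i.1) l =
      cell a β '' {c ∈ range (position a β) | Even (c i₀) ∧ evenCount c = n - 1 - l + 1} := by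
    intro l hl
    rw [← strataComps_restriction]
    refine SigIn_eq_strataComps (by omega) (fun _ => inter_subset_left)
      (fun _ => (isClosed_Hyp _ _).inter (isClosed_Hyp _ _)) (fun x => ?_) hl
    by_cases hx : x ∈ hyps a β i₀
    · have := hgpA.card_incid_le x
      rw [incid_eq_insert_map (H := hyps a β) hx, Finset.card_cons, Finset.card_map] at this
      exact Nat.le_sub_of_add_le this
    · have : incid (fun i : {i : Fin m // i ≠ i₀ ∧ (hyps a β i₀ ∩ hyps a β i).Nonempty} =>
          hyps a β i₀ ∩ hyps a β i.1) x = ∅ :=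
        Finset.eq_empty_of_forall_notMem fun i hi => hx (mem_incid.1 hi).1
      simp [this]
  have hmain := ncard_cells_eq (β := β) i₀ hspanA' (fun x => hgpA _
    ⟨torusProj x, mem_iInter₂.2 fun i hi => mem_incid (K := hyps a β).1 hi⟩) (n - k)
  rw [← strataComps_univ_hyps, ← strataComps_univ_hyps, ← hA, ← hA'] at hmain
  simp only [← Nat.card_coe_set_eq] at hmain
  refine hmain.trans (congrArg₂ _ (congrArg₂ _ rfl ?_) ?_)
  · split_ifs with hkn
    · rw [hA'' k (by omega), show n - 1 - k + 1 = n - k by omega]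
    · have : {c ∈ range (position a β) | Even (c i₀) ∧ evenCount c = n - k} = ∅ := by
        rw [eq_empty_iff_forall_notMem]
        rintro c ⟨-, he, hc⟩
        rw [evenCount_eq_add_ne i₀, if_pos he] at hc
        omega
      rw [this, image_empty, Nat.card_coe_set_eq, ncard_empty]
  · split_ifs with hk0
    · have : {c ∈ range (position a β) | Even (c i₀) ∧ evenCount c = n - k + 1} = ∅ := by
        rw [eq_empty_iff_forall_notMem]
        rintro _ ⟨⟨x, rfl⟩, -, hc⟩
        have := hgpA.card_incid_le (torusProj x)
        rw [← card_incid_torusProj] at hc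
        change (incid (hyps a β) (torusProj x)).card ≤ n at this
        omega
      rw [this, image_empty, Nat.card_coe_set_eq, ncard_empty]
    · rw [hA'' (k - 1) (by omega), show n - 1 - (k - 1) + 1 = n - k + 1 by omega]
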